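/- There is no finite projective plane of order 6. -/

import Mathlib

open scoped Classical

structure ProjPlane (q : ℕ) where
  Point : Type
  fintypePoint : Fintype Point
  L : Set (Set Point)
  unique_line : ∀ p₁ p₂ : Point, p₁ ≠ p₂ → ∃! ℓ, ℓ ∈ L ∧ p₁ ∈ ℓ ∧ p₂ ∈ ℓ
  unique_point : ∀ ℓ₁ ℓ₂, ℓ₁ ∈ L → ℓ₂ ∈ L → ℓ₁ ≠ ℓ₂ → ∃! p, p ∈ ℓ₁ ∧ p ∈ ℓ₂
  nondegenerate : ∃ a b c d : Point, a ≠ b ∧ a ≠ c ∧ a ≠ d ∧ b ≠ c ∧ b ≠ d ∧ c ≠ d ∧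
    ∀ ℓ ∈ L, ¬({a, b, c} ⊆ ℓ) ∧ ¬({a, b, d} ⊆ ℓ) ∧ ¬({a, c, d} ⊆ ℓ) ∧ ¬({b, c, d} ⊆ ℓ)
  line_card : ∀ ℓ ∈ L, ℓ.ncard = q + 1
  point_card : ∀ p : Point, {ℓ ∈ L | p ∈ ℓ}.ncard = q + 1

/-- A set of points is collinear if it is contained in a line. -/
noncomputable def ProjPlane.Collinear {q : ℕ} (Pl : ProjPlane q) (s : Set Pl.Point) : Prop :=
  ∃ ℓ ∈ Pl.L, s ⊆ ℓ

/-- The number of ordered `n`-arcs of the plane. -/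
noncomputable def ProjPlane.nArcs {q : ℕ} (Pl : ProjPlane q) (n : ℕ) : ℕ :=
  Nat.card {p : Fin n → Pl.Point // Function.Injective p ∧
    ∀ i j k : Fin n, i ≠ j → i ≠ k → j ≠ k → ¬ Pl.Collinear {p i, p j, p k}}

/-- Number of ordered strong realizations of the Fano plane. -/
noncomputable def ProjPlane.A7 {q : ℕ} (Pl : ProjPlane q) : ℕ :=
  Nat.card {p : ZMod 7 → Pl.Point // Function.Injective p ∧
    ∃ σ : Equiv.Perm (ZMod 7), ∀ i j k : ZMod 7, i ≠ j → i ≠ k → j ≠ k →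
      (Pl.Collinear {p (σ i), p (σ j), p (σ k)} ↔
        ∃ a : ZMod 7, ({i, j, k} : Set (ZMod 7)) = {a, a + 1, a + 3})}

/-- Number of ordered strong realizations of the Möbius–Kantor configuration. -/
noncomputable def ProjPlane.A8 {q : ℕ} (Pl : ProjPlane q) : ℕ :=
  Nat.card {p : ZMod 8 → Pl.Point // Function.Injective p ∧
    ∃ σ : Equiv.Perm (ZMod 8), ∀ i j k : ZMod 8, i ≠ j → i ≠ k → j ≠ k →
      (Pl.Collinear {p (σ i), p (σ j), p (σ k)} ↔
        ∃ a : ZMod 8, ({i, j, k} : Set (ZMod 8)) = {a, a + 1, a + 3})}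

/-- If the functionals `y i` (`i ∈ s`) and `t` jointly separate points of a subspace `W` of dimension
greater than `#s`, then one can impose `f i = ± y i` for all `i ∈ s` while keeping `t ≠ 0`. -/
theorem exists_sq_eq_sq_of_card_lt_finrank {ι V : Type*} [AddCommGroup V] [Module ℚ V]
    [FiniteDimensional ℚ V] (f y : ι → V →ₗ[ℚ] ℚ) (t : V →ₗ[ℚ] ℚ) (s : Finset ι) :
    ∀ W : Submodule ℚ V, s.card < Module.finrank ℚ W →
      (∀ v ∈ W, (∀ i ∈ s, y i v = 0) → t v = 0 → v = 0) →
      ∃ v ∈ W, (∀ i ∈ s, f i v ^ 2 = y i v ^ 2) ∧ t v ≠ 0 := by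
  classical
  induction s using Finset.induction_on with
  | empty =>
    intro W hW hinj
    obtain ⟨v, hv, hv0⟩ := W.ne_bot_iff.1 fun h => by
      rw [h, finrank_bot] at hW
      simp at hW
    exact ⟨v, hv, by simp, fun h => hv0 (hinj v hv (by simp) h)⟩
  | insert a s ha ih =>
    intro W hW hinj
    rw [Finset.card_insert_of_notMem ha] at hW
    have step : ∀ g : V →ₗ[ℚ] ℚ, (∀ v, g v = 0 → f a v ^ 2 = y a v ^ 2) →
        (∀ v ∈ W, g v = 0 → (∀ i ∈ s, y i v = 0) → t v = 0 → v = 0) →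
        ∃ v ∈ W, (∀ i ∈ insert a s, f i v ^ 2 = y i v ^ 2) ∧ t v ≠ 0 := by
      intro g hg hg'
      have hdim : Module.finrank ℚ W ≤ Module.finrank ℚ ↥(W ⊓ LinearMap.ker g) + 1 := by
        have h₁ := Submodule.finrank_sup_add_finrank_inf_eq W (LinearMap.ker g)
        have h₂ := LinearMap.finrank_range_add_finrank_ker g
        have h₃ := Submodule.finrank_le (LinearMap.range g)
        have h₄ := Submodule.finrank_le (W ⊔ LinearMap.ker g)
        rw [Module.finrank_self] at h₃
        omega
      obtain ⟨v, hv, hfy, htv⟩ := ih (W ⊓ LinearMap.ker g) (by omega)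
        fun v hv => hg' v hv.1 (LinearMap.mem_ker.1 hv.2)
      refine ⟨v, hv.1, ?_, htv⟩
      rw [Finset.forall_mem_insert]
      exact ⟨hg v (LinearMap.mem_ker.1 hv.2), hfy⟩
    by_cases hbad : ∀ v ∈ W, (f a - y a) v = 0 → (∀ i ∈ s, y i v = 0) → t v = 0 → v = 0
    · refine step (f a - y a) (fun v hv => ?_) hbad
      rw [LinearMap.sub_apply, sub_eq_zero] at hv
      rw [hv]
    · push Not at hbad
      obtain ⟨u, huW, hu, hus, hut, hu0⟩ := hbad
      have huy : y a u ≠ 0 := fun h =>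
        hu0 (hinj u huW (by rw [Finset.forall_mem_insert]; exact ⟨h, hus⟩) hut)
      rw [LinearMap.sub_apply, sub_eq_zero] at hu
      refine step (f a + y a) (fun v hv => ?_) fun v hvW hv hvs hvt => ?_
      · rw [LinearMap.add_apply, add_eq_zero_iff_eq_neg] at hv
        rw [hv, neg_sq]
      · rw [LinearMap.add_apply] at hv
        -- `v` is a multiple of `u`, on which `f a = y a`
        have hvu : y a u • v - y a v • u = 0 := by
          refine hinj _ (W.sub_mem (W.smul_mem _ hvW) (W.smul_mem _ huW)) ?_ ?_
          · rw [Finset.forall_mem_insert]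
            refine ⟨by simp [mul_comm], fun i hi => by simp [hvs i hi, hus i hi]⟩
          · simp [hvt, hut]
        have hf := congrArg (f a) hvu
        simp only [map_sub, map_smul, smul_eq_mul, hu, map_zero] at hf
        have hyv : y a v = 0 := by
          have h : y a u * (2 * y a v) = 0 := by linear_combination y a u * hv - hf
          simpa [huy] using h
        rw [hyv, zero_smul, sub_zero, smul_eq_zero] at hvu
        exact hvu.resolve_left huy

/-- The form `y² + w² - 6x²` is anisotropic over `ℚ`. -/
theorem eq_zero_of_sq_add_sq_eq_six_mul_sq {y w x : ℚ} (h : y ^ 2 + w ^ 2 = 6 * x ^ 2) : y = 0 := by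
  by_contra hy
  have hx : x ≠ 0 := by
    rintro rfl
    exact hy (pow_eq_zero_iff two_ne_zero |>.1 (by nlinarith [sq_nonneg y, sq_nonneg w]))
  have hint : (y.num * w.den * x.den) ^ 2 + (w.num * y.den * x.den) ^ 2
      = 6 * (x.num * y.den * w.den) ^ 2 := by
    have hyd : (y.den : ℚ) ≠ 0 := by exact_mod_cast y.den_ne_zero
    have hwd : (w.den : ℚ) ≠ 0 := by exact_mod_cast w.den_ne_zero
    have hxd : (x.den : ℚ) ≠ 0 := by exact_mod_cast x.den_ne_zero
    rw [← Rat.num_div_den y, ← Rat.num_div_den w, ← Rat.num_div_den x] at h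
    field_simp at h
    have h' : ((y.num : ℚ) * w.den * x.den) ^ 2 + (w.num * y.den * x.den) ^ 2
      = 6 * (x.num * y.den * w.den) ^ 2 := by linear_combination h
    exact_mod_cast h'
  set z : ℤ := x.num * y.den * w.den with hz
  have hz0 : z.natAbs ≠ 0 := by simp [hz, hx]
  have hnat : 6 * z.natAbs ^ 2 = (y.num * w.den * x.den).natAbs ^ 2
      + (w.num * y.den * x.den).natAbs ^ 2 := by
    zify
    simp only [sq_abs]
    exact hint.symm
  have heven := Nat.eq_sq_add_sq_iff.1 ⟨_, _, hnat⟩ (q := 3)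
    (Nat.mem_primeFactors.2 ⟨Nat.prime_three, Dvd.dvd.mul_right (by norm_num) _, by positivity⟩)
    (by norm_num)
  have : Fact (Nat.Prime 3) := ⟨Nat.prime_three⟩
  have h6 : padicValNat 3 6 = 1 := by
    rw [show 6 = 3 * 2 from rfl, padicValNat.mul (by norm_num) (by norm_num), padicValNat_self,
      padicValNat.eq_zero_of_not_dvd (by norm_num)]
  rw [padicValNat.mul (by norm_num) (by positivity), padicValNat.pow, h6] at heven
  exact absurd heven (by simp [parity_simps])

namespace ProjPlane

variable {q : ℕ} (Pl : ProjPlane q)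

instance : Finite Pl.Point := @Finite.of_fintype _ Pl.fintypePoint

noncomputable instance : Fintype Pl.Point := Pl.fintypePoint

noncomputable instance : Fintype Pl.L := Fintype.ofFinite _

instance : Membership Pl.Point Pl.L := ⟨fun ℓ p => p ∈ ℓ.1⟩

theorem exists_line {p₁ p₂ : Pl.Point} (h : p₁ ≠ p₂) : ∃ ℓ : Pl.L, p₁ ∈ ℓ ∧ p₂ ∈ ℓ := by
  obtain ⟨ℓ, ⟨hL, h₁, h₂⟩, -⟩ := Pl.unique_line p₁ p₂ h
  exact ⟨⟨ℓ, hL⟩, h₁, h₂⟩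

theorem line_eq_of_mem {p₁ p₂ : Pl.Point} (h : p₁ ≠ p₂) {ℓ m : Pl.L}
    (h₁ : p₁ ∈ ℓ) (h₂ : p₂ ∈ ℓ) (h₁' : p₁ ∈ m) (h₂' : p₂ ∈ m) : ℓ = m :=
  Subtype.ext ((Pl.unique_line p₁ p₂ h).unique ⟨ℓ.2, h₁, h₂⟩ ⟨m.2, h₁', h₂'⟩)

theorem exists_point {ℓ m : Pl.L} (h : ℓ ≠ m) : ∃ p : Pl.Point, p ∈ ℓ ∧ p ∈ m :=
  (Pl.unique_point ℓ.1 m.1 ℓ.2 m.2 fun e => h (Subtype.ext e)).exists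

theorem exists_triangle : ∃ (p₁ p₂ p₃ : Pl.Point) (l₁ l₂ l₃ : Pl.L),
    p₁ ∉ l₂ ∧ p₁ ∉ l₃ ∧ p₂ ∉ l₁ ∧ p₂ ∈ l₂ ∧ p₂ ∈ l₃ ∧ p₃ ∉ l₁ ∧ p₃ ∈ l₂ ∧ p₃ ∉ l₃ := by
  obtain ⟨a, b, c, d, hab, hac, had, hbc, hbd, hcd, H⟩ := Pl.nondegenerate
  obtain ⟨l₁, h₁a, h₁d⟩ := Pl.exists_line had
  obtain ⟨l₂, h₂b, h₂c⟩ := Pl.exists_line hbc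
  obtain ⟨l₃, h₃b, h₃d⟩ := Pl.exists_line hbd
  have sub : ∀ {x y z : Pl.Point} {ℓ : Pl.L}, x ∈ ℓ → y ∈ ℓ → z ∈ ℓ → {x, y, z} ⊆ ℓ.1 := by
    rintro x y z ℓ hx hy hz w (rfl | rfl | rfl) <;> assumption
  refine ⟨a, b, c, l₁, l₂, l₃, fun h => ?_, fun h => ?_, fun h => ?_, h₂b, h₃b, fun h => ?_, h₂c,
    fun h => ?_⟩
  · exact (H l₂ l₂.2).1 (sub h h₂b h₂c)
  · exact (H l₃ l₃.2).2.1 (sub h h₃b h₃d)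
  · exact (H l₁ l₁.2).2.1 (sub h₁a h h₁d)
  · exact (H l₁ l₁.2).2.2.1 (sub h₁a h h₁d)
  · exact (H l₃ l₃.2).2.2.2 (sub h₃b h h₃d)

noncomputable instance : Configuration.ProjectivePlane Pl.Point Pl.L where
  exists_point ℓ := by
    by_contra! h
    have h0 : ℓ.1 = Set.univ := Set.eq_univ_of_forall h
    obtain ⟨a, b, c, d, H⟩ := Pl.nondegenerate
    exact (H.2.2.2.2.2.2 ℓ ℓ.2).1 (by rw [h0]; exact Set.subset_univ _)
  exists_line p := by
    by_contra! h
    obtain ⟨p₁, p₂, p₃, l₁, l₂, l₃, h₁₂, h₁₃, h₂₁, h₂₂, h₂₃, h₃₁, h₃₂, h₃₃⟩ := Pl.exists_triangle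
    have h₂ : p = p₂ := by
      by_contra hne
      exact h₃₃ (Pl.line_eq_of_mem hne (h l₂) h₂₂ (h l₃) h₂₃ ▸ h₃₂)
    exact h₂₁ (h₂ ▸ h l₁)
  eq_or_eq {p₁ p₂ l₁ l₂} h₁ h₂ h₃ h₄ := by
    by_contra! h
    exact h.2 (Pl.line_eq_of_mem h.1 h₁ h₂ h₃ h₄)
  mkPoint h := (Pl.exists_point h).choose
  mkPoint_ax h := (Pl.exists_point h).choose_spec
  mkLine h := (Pl.exists_line h).choose
  mkLine_ax h := (Pl.exists_line h).choose_spec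
  exists_config := Pl.exists_triangle

theorem card_lines_through (p : Pl.Point) :
    (Finset.univ.filter fun ℓ : Pl.L => p ∈ ℓ).card = q + 1 := by
  rw [← Pl.point_card p, ← Set.ncard_coe_finset,
    ← Set.ncard_image_of_injective _ Subtype.val_injective]
  congr 1
  ext ℓ
  constructor
  · rintro ⟨m, hm, rfl⟩
    exact ⟨m.2, (Finset.mem_filter.1 hm).2⟩
  · rintro ⟨hL, hp⟩
    exact ⟨⟨ℓ, hL⟩, by simpa using hp, rfl⟩

theorem order_eq : Configuration.ProjectivePlane.order Pl.Point Pl.L = q := by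
  obtain ⟨p, -⟩ := Pl.nondegenerate
  have h := Configuration.ProjectivePlane.lineCount_eq (L := Pl.L) p
  rw [Configuration.lineCount, Nat.card_eq_fintype_card, Fintype.card_subtype,
    Pl.card_lines_through] at h
  omega

theorem card_lines_through_pair (p r : Pl.Point) :
    (Finset.univ.filter fun ℓ : Pl.L => p ∈ ℓ ∧ r ∈ ℓ).card = if p = r then q + 1 else 1 := by
  split_ifs with h
  · simp [h, Pl.card_lines_through]
  · obtain ⟨ℓ, h₁, h₂⟩ := Pl.exists_line h
    rw [Finset.card_eq_one]
    refine ⟨ℓ, ?_⟩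
    ext m
    simp only [Finset.mem_filter, Finset.mem_univ, true_and, Finset.mem_singleton]
    exact ⟨fun hm => Pl.line_eq_of_mem h hm.1 hm.2 h₁ h₂, fun hm => hm ▸ ⟨h₁, h₂⟩⟩

theorem sum_sq_line_sums (x : Pl.Point → ℚ) :
    ∑ ℓ : Pl.L, (∑ p, if p ∈ ℓ then x p else 0) ^ 2 = q * ∑ p, x p ^ 2 + (∑ p, x p) ^ 2 := by
  have h : ∀ p r, ∑ ℓ : Pl.L, (if p ∈ ℓ then x p else 0) * (if r ∈ ℓ then x r else 0)
      = (if p = r then q * (x p * x r) else 0) + x p * x r := by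
    intro p r
    have h₁ : ∀ ℓ : Pl.L, (if p ∈ ℓ then x p else 0) * (if r ∈ ℓ then x r else 0)
        = if p ∈ ℓ ∧ r ∈ ℓ then x p * x r else 0 := by
      intro ℓ
      by_cases hp : p ∈ ℓ <;> by_cases hr : r ∈ ℓ <;> simp [hp, hr]
    rw [Finset.sum_congr rfl fun ℓ _ => h₁ ℓ, ← Finset.sum_filter, Finset.sum_const,
      Pl.card_lines_through_pair]
    split_ifs <;> simp
    ring
  simp only [sq, Finset.sum_mul_sum]
  rw [Finset.sum_comm]
  simp_rw [Finset.sum_comm (s := (Finset.univ : Finset Pl.L)), h, Finset.sum_add_distrib]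
  simp [Finset.mul_sum]

end ProjPlane

/-- Multiplication by the quaternion `2 + i + j`, of norm `6`, in coordinates. -/
def quaternionForm {κ : Type*} (x : κ × Fin 4 → ℚ) (k : κ × Fin 4) : ℚ :=
  ![2 * x (k.1, 0) + x (k.1, 1) + x (k.1, 2),
    -x (k.1, 0) + 2 * x (k.1, 1) + x (k.1, 3),
    -x (k.1, 0) + 2 * x (k.1, 2) - x (k.1, 3),
    -x (k.1, 1) + x (k.1, 2) + 2 * x (k.1, 3)] k.2

theorem sum_quaternionForm_sq {κ : Type*} [Fintype κ] (x : κ × Fin 4 → ℚ) :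
    ∑ k, quaternionForm x k ^ 2 = 6 * ∑ k, x k ^ 2 := by
  rw [Fintype.sum_prod_type, Fintype.sum_prod_type, Finset.mul_sum]
  refine Finset.sum_congr rfl fun k _ => ?_
  simp [Fin.sum_univ_four, quaternionForm]
  ring

/-- `quaternionForm` as a family of linear functionals, transported along an equivalence. -/
def quaternionFunctional {κ ι : Type*} (e : κ × Fin 4 ≃ ι) (i : ι) : (ι → ℚ) →ₗ[ℚ] ℚ where
  toFun x := quaternionForm (x ∘ e) (e.symm i)
  map_add' x y := by
    obtain ⟨⟨k, j⟩, rfl⟩ := e.surjective i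
    fin_cases j <;> simp [quaternionForm] <;> ring
  map_smul' c x := by
    obtain ⟨⟨k, j⟩, rfl⟩ := e.surjective i
    fin_cases j <;> simp [quaternionForm] <;> ring

theorem sum_quaternionFunctional_sq {κ ι : Type*} [Fintype κ] [Fintype ι] (e : κ × Fin 4 ≃ ι)
    (x : ι → ℚ) : ∑ i, quaternionFunctional e i x ^ 2 = 6 * ∑ i, x i ^ 2 := by
  rw [← e.sum_comp, ← e.sum_comp, ← Function.comp_def (fun i => x i ^ 2) e]
  simpa [quaternionFunctional] using sum_quaternionForm_sq (x ∘ e)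

/-- There is no finite projective plane of order 6. -/
theorem no_projective_plane_of_order_six (Pl : ProjPlane 6) : False := by
  have hP : Fintype.card Pl.Point = 43 := by
    rw [Configuration.ProjectivePlane.card_points Pl.Point Pl.L, Pl.order_eq]
    norm_num
  have hL : Fintype.card Pl.L = 43 := by
    rw [Configuration.ProjectivePlane.card_lines Pl.Point Pl.L, Pl.order_eq]
    norm_num
  let e : Fin 11 × Fin 4 ≃ Option Pl.Point := Fintype.equivOfCardEq (by simp [hP])
  let g : Pl.Point ≃ Pl.L := Fintype.equivOfCardEq (by rw [hP, hL])
  let Y := quaternionFunctional e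
  let f : Pl.Point → (Option Pl.Point → ℚ) →ₗ[ℚ] ℚ := fun p =>
    ∑ r, if r ∈ g p then LinearMap.proj (some r) else 0
  have hf : ∀ p v, f p v = ∑ r, if r ∈ g p then v (some r) else 0 := by
    intro p v
    simp only [f, LinearMap.sum_apply]
    refine Finset.sum_congr rfl fun r _ => ?_
    split_ifs <;> simp
  have hY : ∀ v, ∑ p, Y (some p) v ^ 2 + Y none v ^ 2 = 6 * (∑ p, v (some p) ^ 2 + v none ^ 2) := by
    intro v
    have h := sum_quaternionFunctional_sq e v
    rw [Fintype.sum_option, Fintype.sum_option] at h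
    linear_combination h
  obtain ⟨v, -, hv, ht⟩ := exists_sq_eq_sq_of_card_lt_finrank f (fun p => Y (some p)) (Y none)
    Finset.univ ⊤ (by simp [hP]) fun v _ hv ht => by
      have h := hY v
      simp only [hv _ (Finset.mem_univ _), ht] at h
      have hs : ∑ o, v o ^ 2 = 0 := by
        rw [Fintype.sum_option]
        simp at h
        linarith
      rw [Finset.sum_eq_zero_iff_of_nonneg fun _ _ => sq_nonneg _] at hs
      ext o
      simpa using hs o (Finset.mem_univ o)
  have hsum : ∑ p, f p v ^ 2 = 6 * ∑ p, v (some p) ^ 2 + (∑ p, v (some p)) ^ 2 := by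
    have h := Pl.sum_sq_line_sums fun p => v (some p)
    rw [← g.sum_comp] at h
    simp_rw [hf]
    exact_mod_cast h
  rw [Finset.sum_congr rfl fun p hp => hv p hp] at hsum
  exact ht (eq_zero_of_sq_add_sq_eq_six_mul_sq (w := ∑ p, v (some p)) (x := v none) (by
    linear_combination hY v - hsum))
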